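/- Let ν, μ ∈ ℕ with μ ≥ 1 and complex matrices f_x : ℂ^{ν×ν}, f_y : ℂ^{ν×μ}, g_x : ℂ^{μ×ν}, and g_y : ℂ^{μ×μ} invertible. Set A_s := f_x − f_y g_y⁻¹ g_x, h ∈ ℂ, r ≥ 1, C_j := Σ_{i=0}^{j} ((h/2)•f_x)^i, B := (h/2)•C_{r−1}, and M := B f_y g_y⁻¹ g_x. Then for every z ∈ ℂ, det( z•[[I, −B f_y],[g_x, g_y]] − [[I + h•C_r f_x, (h•C_r − B) f_y],[0, 0]] ) = z^μ · det(g_y) · det( z•(I + M) − (I + h•C_r A_s + M) ). -/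

import Mathlib

open Matrix Finset

/-- The matrix geometric sum `C_j = ∑_{i=0}^{j} ((h/2) • A)^i`. -/
noncomputable def Cmat {n : Type*} [Fintype n] [DecidableEq n] {K : Type*} [Field K]
    (h : K) (A : Matrix n n K) (j : ℕ) : Matrix n n K :=
  ∑ i ∈ Finset.range (j + 1), ((h / 2) • A) ^ i

/-- Schur complement formula for the determinant of a block matrix whose lower blocks carry a
common scalar factor, which need not be invertible. -/
theorem det_fromBlocks_smul_lower {m n R : Type*} [Fintype m] [Fintype n] [DecidableEq m]
    [DecidableEq n] [CommRing R] (z : R) (A : Matrix m m R) (B : Matrix m n R)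
    (C : Matrix n m R) (D : Matrix n n R) (hD : IsUnit D.det) :
    (Matrix.fromBlocks A B (z • C) (z • D)).det
      = z ^ Fintype.card n * D.det * (A - B * D⁻¹ * C).det := by
  let _ : Invertible D := Matrix.invertibleOfIsUnitDet D hD
  have hfactor : Matrix.fromBlocks A B (z • C) (z • D)
      = Matrix.fromBlocks 1 0 0 (z • (1 : Matrix n n R)) * Matrix.fromBlocks A B C D := by
    simp [Matrix.fromBlocks_multiply]
  rw [hfactor, Matrix.det_mul, Matrix.det_fromBlocks_zero₂₁, Matrix.det_fromBlocks₂₂,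
    Matrix.invOf_eq_nonsing_inv, Matrix.det_one, Matrix.det_smul, Matrix.det_one]
  ring

/-- The determinant of the sparse pencil `P̄_PC(z)` of the linearized Heun scheme with
perfect interfacing factors as
`det P̄_PC(z) = z^μ · det(g_y) · det(z•(I + M) − (I + h C_r A_s + M))`,
where `B = (h/2) C_{r−1}`, `M = B f_y g_y⁻¹ g_x` and `A_s = f_x − f_y g_y⁻¹ g_x`. -/
theorem heun_perfect_interfacing_pencil_det (ν μ : ℕ) (hμ : 1 ≤ μ) (h : ℂ)
    (r : ℕ) (hr : 1 ≤ r)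
    (f_x : Matrix (Fin ν) (Fin ν) ℂ) (f_y : Matrix (Fin ν) (Fin μ) ℂ)
    (g_x : Matrix (Fin μ) (Fin ν) ℂ) (g_y : Matrix (Fin μ) (Fin μ) ℂ)
    (hgy : IsUnit g_y.det) :
    ∀ z : ℂ,
      (z • (Matrix.fromBlocks (1 : Matrix (Fin ν) (Fin ν) ℂ)
            (-(((h / 2) • Cmat h f_x (r - 1)) * f_y)) g_x g_y)
        - Matrix.fromBlocks (1 + h • (Cmat h f_x r * f_x))
            ((h • Cmat h f_x r - (h / 2) • Cmat h f_x (r - 1)) * f_y)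
            0 0).det
      = z ^ μ * g_y.det
        * (z • (1 + ((h / 2) • Cmat h f_x (r - 1)) * (f_y * g_y⁻¹ * g_x))
            - (1 + h • (Cmat h f_x r * (f_x - f_y * g_y⁻¹ * g_x))
                + ((h / 2) • Cmat h f_x (r - 1)) * (f_y * g_y⁻¹ * g_x))).det := by
  intro z
  generalize (h / 2) • Cmat h f_x (r - 1) = B
  generalize Cmat h f_x r = C
  rw [Matrix.fromBlocks_smul, sub_eq_add_neg, Matrix.fromBlocks_neg, Matrix.fromBlocks_add,
    neg_zero, neg_zero, add_zero, add_zero, det_fromBlocks_smul_lower z _ _ _ _ hgy,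
    Fintype.card_fin]
  congr 2
  simp only [Matrix.add_mul, Matrix.mul_sub, Matrix.sub_mul, Matrix.neg_mul, Matrix.smul_mul,
    Matrix.mul_assoc, smul_add, smul_sub, smul_neg]
  abel
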